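/- arXiv:1205.2905 — 3 statements merged into one kernel-verified Lean document; each statement's English description precedes it below -/
import Mathlib

section
/- For every σ-ergodic shift-invariant Borel probability measure μ on the squarefree flow X with μ(X₁) = 1, one has μ(Y) = ∏_p (1 − 1/p²). -/
open MeasureTheory Filter Set
open scoped ENNReal Classical

noncomputable section

/-- The sequence space `{0,1}^{ℕ*}`; index `n : ℕ` represents the positive integer `n + 1`. -/
abbrev Omega2 : Type := ℕ → Bool

/-- The left shift `(σ x)_n = x_{n+1}`. -/
def shift : Omega2 → Omega2 := fun x n => x (n + 1)

/-- `x` omits the residue class `a` modulo `q` (the position of index `n` is `n + 1`). -/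
def OmitsMod (x : Omega2) (q : ℕ) (a : ZMod q) : Prop :=
  ∀ n : ℕ, ((n + 1 : ℕ) : ZMod q) = a → x n = false

/-- The squarefree flow: sequences whose support omits at least one residue class
modulo `p ^ 2` for every prime `p`. -/
def SqfFlow : Set Omega2 :=
  {x | ∀ p : Nat.Primes, ∃ a : ZMod ((p : ℕ) ^ 2), OmitsMod x ((p : ℕ) ^ 2) a}

instance (p : Nat.Primes) : NeZero ((p : ℕ) ^ 2) := ⟨pow_ne_zero 2 p.2.ne_zero⟩
instance (n : ℕ) : MeasurableSpace (ZMod n) := ⊤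
instance (n : ℕ) : TopologicalSpace (ZMod n) := ⊥
instance (n : ℕ) : DiscreteTopology (ZMod n) := ⟨rfl⟩

/-- The group `G = ∏_p ℤ/p²ℤ`. -/
abbrev G : Type := ∀ p : Nat.Primes, ZMod ((p : ℕ) ^ 2)

/-- Translation by `(-1, -1, -1, …)` on `G`. -/
def T1 : G → G := fun g p => g p - 1

/-- `G₁ = {g : g_p ≡ 1 mod p² for some prime p}`. -/
def G1 : Set G := {g | ∃ p : Nat.Primes, g p = 1}

/-- Shannon entropy of the finite partition of `α` induced by `f`. -/
def partH {α β : Type*} [MeasurableSpace α] [Fintype β] (μ : Measure α) (f : α → β) : ℝ :=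
  ∑ b : β, Real.negMulLog ((μ (f ⁻¹' {b})).toReal)

/-- Entropy of the process generated by the observable `f` under `T`. -/
def procH {α : Type*} [MeasurableSpace α] (μ : Measure α) (T : α → α)
    {k : ℕ} (f : α → Fin k) : ℝ :=
  ⨅ n : ℕ, partH μ (fun x (i : Fin (n + 1)) => f (T^[(i : ℕ)] x)) / (n + 1)

/-- Kolmogorov–Sinai entropy of `T` with respect to `μ`: supremum over finite measurable
partitions (encoded as finite-valued measurable observables). -/
def ksEntropy {α : Type*} [MeasurableSpace α] (μ : Measure α) (T : α → α) : EReal :=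
  ⨆ (k : ℕ) (f : α → Fin k) (_ : Measurable f), ((procH μ T f : ℝ) : EReal)

/-- First return time (`0` if the point never returns). -/
def retTime {α : Type*} (T : α → α) (Y : Set α) (x : α) : ℕ :=
  sInf {n : ℕ | 0 < n ∧ T^[n] x ∈ Y}

/-- Induced (first–return) transformation, as a map of the ambient space. -/
def inducedAmb {α : Type*} (T : α → α) (Y : Set α) (x : α) : α :=
  T^[retTime T Y x] x

/-- Number of omitted residue classes modulo `q`. -/
def numOmitted (x : Omega2) (q : ℕ) : ℕ := Set.ncard {a : ZMod q | OmitsMod x q a}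

/-- `x` is persistent modulo `q`: every residue class meeting the support meets it infinitely. -/
def Persistent (x : Omega2) (q : ℕ) : Prop :=
  ∀ a : ZMod q, (∃ n : ℕ, ((n + 1 : ℕ) : ZMod q) = a ∧ x n = true) →
    {n : ℕ | ((n + 1 : ℕ) : ZMod q) = a ∧ x n = true}.Infinite

/-- The set of `p`-persistent sequences in the squarefree flow. -/
def SP (p : Nat.Primes) : Set Omega2 := {x ∈ SqfFlow | Persistent x ((p : ℕ) ^ 2)}

/-- `X_I`: sequences omitting exactly `I p` classes mod `p²` and persistent for every `p`. -/
def XI (I : Nat.Primes → ℕ) : Set Omega2 :=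
  {x ∈ SqfFlow | (∀ p : Nat.Primes, numOmitted x ((p : ℕ) ^ 2) = I p) ∧
    ∀ p : Nat.Primes, Persistent x ((p : ℕ) ^ 2)}

/-- `X₁ = X_{(1,1,1,…)}`. -/
def X1 : Set Omega2 := XI fun _ => 1

/-- `ρ(x)_p` is the (unique, for `x ∈ X₁`) omitted residue class mod `p²`. -/
def rho (x : Omega2) : G := fun p =>
  if h : ∃ a : ZMod ((p : ℕ) ^ 2), OmitsMod x ((p : ℕ) ^ 2) a then h.choose else 0

/-- `Y = ρ⁻¹(G₁ᶜ) ⊆ X₁`. -/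
def Y : Set Omega2 := {x ∈ X1 | rho x ∈ G1ᶜ}

/-- `α_g(m) = #{1 ≤ n ≤ m : n ≡ g_p mod p² for some prime p}`. -/
def alphaG (g : G) (m : ℕ) : ℕ :=
  Set.ncard {n : ℕ | 1 ≤ n ∧ n ≤ m ∧ ∃ p : Nat.Primes, ((n : ℕ) : ZMod ((p : ℕ) ^ 2)) = g p}

/-- The insertion map `ι : G × Ω⁽²⁾ → X`; position of index `n` is `m = n + 1`, and the
`1`-based value `y_{m - α_g(m)}` is the `0`-based entry `y (n - α_g(n+1))`. -/
def iota (g : G) (y : Omega2) : Omega2 := fun n =>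
  if ∃ p : Nat.Primes, ((n + 1 : ℕ) : ZMod ((p : ℕ) ^ 2)) = g p then false
  else y (n - alphaG g (n + 1))

/-- The skew product `T(g,y) = (T₁ g, σ^{ψ(g)} y)`, `ψ = 1 - 1_{G₁}`. -/
def skewT : G × Omega2 → G × Omega2 := fun gy =>
  if gy.1 ∈ G1 then (T1 gy.1, gy.2) else (T1 gy.1, shift gy.2)

/-- `G₁ᶜ × Ω⁽²⁾` as a subset of `G × Ω⁽²⁾`. -/
def ZSet : Set (G × Omega2) := G1ᶜ ×ˢ (Set.univ : Set Omega2)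

/-- `x̂`: delete from `x` the entries at positions congruent to `(g_x)_p` mod `p²` for some `p`. -/
def hat (x : Omega2) : Omega2 := fun m =>
  x (Nat.nth (fun j => ¬ ∃ p : Nat.Primes, ((j + 1 : ℕ) : ZMod ((p : ℕ) ^ 2)) = rho x p) m)

/-- A Haar probability measure on `G`: a translation-invariant Borel probability measure. -/
def IsHaarLike (m : Measure G) : Prop :=
  IsProbabilityMeasure m ∧ ∀ g : G, MeasurePreserving (fun h => g + h) m m

/-- The `(1/2, 1/2)` Bernoulli measure on `Ω⁽²⁾`, characterized by its cylinder values. -/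
def IsBernoulliHalf (ω : Measure Omega2) : Prop :=
  IsProbabilityMeasure ω ∧
    ∀ (s : Finset ℕ) (v : ℕ → Bool), ω {x | ∀ i ∈ s, x i = v i} = (1 / 2 : ℝ≥0∞) ^ s.card

/-- Normalized restriction of a measure on `G` to `G₁ᶜ`. -/
def mbar (m : Measure G) : Measure G := (m G1ᶜ)⁻¹ • m.restrict G1ᶜ

/-- The `k`-th prime (`0`-indexed), as an element of `Nat.Primes`. -/
def nthPrime (k : ℕ) : Nat.Primes := ⟨Nat.nth Nat.Prime k, Nat.prime_nth_prime k⟩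

/-- `X(r)`: sequences omitting at least one class mod `p_i²` for the first `r` primes. -/
def Xr (r : ℕ) : Set Omega2 :=
  {x | ∀ k : Fin r, ∃ a : ZMod ((nthPrime k : ℕ) ^ 2), OmitsMod x ((nthPrime k : ℕ) ^ 2) a}

/-- `X_I(r)`: elements of `X(r)` omitting exactly `I k` classes mod `p_k²` for `k ≤ r`. -/
def XIr (r : ℕ) (I : Fin r → ℕ) : Set Omega2 :=
  {x ∈ Xr r | ∀ k : Fin r, numOmitted x ((nthPrime k : ℕ) ^ 2) = I k}

/-- Number of distinct words of length `L` occurring in elements of `F`. -/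
def wordCount (F : Set Omega2) (L : ℕ) : ℕ :=
  Set.ncard {w : Fin L → Bool | ∃ x ∈ F, ∃ j : ℕ, ∀ t : Fin L, w t = x (j + (t : ℕ))}

/-- `α_g^r(m)`, counting only the first `r` primes. -/
def alphaGr (r : ℕ) (g : G) (m : ℕ) : ℕ :=
  Set.ncard {n : ℕ | 1 ≤ n ∧ n ≤ m ∧
    ∃ k : Fin r, ((n : ℕ) : ZMod ((nthPrime k : ℕ) ^ 2)) = g (nthPrime k)}

/-- The partial insertion map `ι_r`. -/
def iotaR (r : ℕ) (g : G) (y : Omega2) : Omega2 := fun n =>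
  if ∃ k : Fin r, ((n + 1 : ℕ) : ZMod ((nthPrime k : ℕ) ^ 2)) = g (nthPrime k) then false
  else y (n - alphaGr r g (n + 1))

section OmittedResidues

lemma measurableSet_omitsMod (q : ℕ) (a : ZMod q) : MeasurableSet {x | OmitsMod x q a} := by
  unfold OmitsMod
  measurability

lemma numOmitted_eq_one_iff {x : Omega2} {q : ℕ} :
    numOmitted x q = 1 ↔ ∃ a : ZMod q, ∀ b, OmitsMod x q b ↔ b = a := by
  simp [numOmitted, Set.ncard_eq_one, Set.ext_iff]

lemma Persistent.omitsMod_shift_iff {x : Omega2} {q : ℕ} (hx : Persistent x q) (a : ZMod q) :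
    OmitsMod (shift x) q a ↔ OmitsMod x q (a + 1) := by
  refine ⟨fun h n hn => ?_, fun h n hn => h (n + 1) ?_⟩
  · by_contra hxn
    obtain ⟨m, ⟨hm, hxm⟩, hm0⟩ :=
      (hx (a + 1) ⟨n, hn, by simpa using hxn⟩).exists_gt 0
    obtain ⟨k, rfl⟩ := Nat.exists_eq_add_one.2 hm0
    have := h k (by push_cast at hm ⊢; exact add_right_cancel hm)
    simp [shift, hxm] at this
  · push_cast at hn ⊢
    rw [hn]

lemma measurableSet_persistent (q : ℕ) [NeZero q] : MeasurableSet {x | Persistent x q} := by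
  have : {x | Persistent x q} = {x | ∀ a : ZMod q, OmitsMod x q a ∨
      ∀ N : ℕ, ∃ n : ℕ, N < n ∧ ((n + 1 : ℕ) : ZMod q) = a ∧ x n = true} := by
    ext x
    simp only [Persistent, OmitsMod, mem_ofPred_eq]
    refine forall_congr' fun a => ?_
    rw [imp_iff_not_or]
    refine or_congr ?_ ?_
    · simp
    · refine ⟨fun h N => ?_, fun h => Set.infinite_of_forall_exists_gt fun N => ?_⟩
      · obtain ⟨n, hn, hN⟩ := h.exists_gt N
        exact ⟨n, hN, hn⟩
      · obtain ⟨n, hN, hn⟩ := h N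
        exact ⟨n, hn, hN⟩
  rw [this]
  have := measurableSet_omitsMod q
  simp only [ofPred_forall, ofPred_or, ofPred_exists, ofPred_and]
  refine .iInter fun a => (this a).union <| .iInter fun N => .iUnion fun n =>
    (MeasurableSet.const _).inter <| (MeasurableSet.const _).inter ?_
  exact measurableSet_eq_fun (measurable_pi_apply n) measurable_const

lemma mem_X1_iff {x : Omega2} :
    x ∈ X1 ↔ ∀ p : Nat.Primes, numOmitted x ((p : ℕ) ^ 2) = 1 ∧ Persistent x ((p : ℕ) ^ 2) := by
  refine ⟨fun h p => ⟨h.2.1 p, h.2.2 p⟩, fun h => ⟨fun p => ?_, fun p => (h p).1, fun p => (h p).2⟩⟩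
  obtain ⟨a, ha⟩ := numOmitted_eq_one_iff.1 (h p).1
  exact ⟨a, (ha a).2 rfl⟩

lemma measurableSet_X1 : MeasurableSet X1 := by
  have : X1 = ⋂ p : Nat.Primes, {x | numOmitted x ((p : ℕ) ^ 2) = 1} ∩
      {x | Persistent x ((p : ℕ) ^ 2)} := by
    ext x
    simp [mem_X1_iff]
  rw [this]
  refine .iInter fun p => .inter ?_ (measurableSet_persistent _)
  simp only [numOmitted_eq_one_iff, ofPred_exists, ofPred_forall]
  exact .iUnion fun a => .iInter fun b =>
    (measurableSet_omitsMod _ b).iff (MeasurableSet.const _)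

lemma omitsMod_iff_of_mem_X1 {x : Omega2} (hx : x ∈ X1) (p : Nat.Primes)
    (a : ZMod ((p : ℕ) ^ 2)) : OmitsMod x ((p : ℕ) ^ 2) a ↔ a = rho x p := by
  obtain ⟨b, hb⟩ := numOmitted_eq_one_iff.1 (mem_X1_iff.1 hx p).1
  have hex : ∃ a : ZMod ((p : ℕ) ^ 2), OmitsMod x ((p : ℕ) ^ 2) a := ⟨b, (hb b).2 rfl⟩
  have hrho : OmitsMod x ((p : ℕ) ^ 2) (rho x p) := by
    rw [rho, dif_pos hex]
    exact hex.choose_spec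
  rw [hb, (hb _).1 hrho]

/-- The sequences in `X₁` whose omitted classes at the primes in `S` are given by `h`. -/
def omittedFiber (S : Finset Nat.Primes) (h : ∀ p : S, ZMod ((p : ℕ) ^ 2)) : Set Omega2 :=
  {x ∈ X1 | ∀ p : S, rho x p = h p}

lemma omittedFiber_eq (S : Finset Nat.Primes) (h : ∀ p : S, ZMod ((p : ℕ) ^ 2)) :
    omittedFiber S h = X1 ∩ ⋂ p : S, {x | OmitsMod x ((p : ℕ) ^ 2) (h p)} := by
  ext x
  simp only [omittedFiber, mem_ofPred_eq, mem_inter_iff, mem_iInter]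
  refine and_congr_right fun hx => forall_congr' fun p => ?_
  rw [omitsMod_iff_of_mem_X1 hx, eq_comm]

lemma measurableSet_omittedFiber (S : Finset Nat.Primes) (h : ∀ p : S, ZMod ((p : ℕ) ^ 2)) :
    MeasurableSet (omittedFiber S h) := by
  rw [omittedFiber_eq]
  exact measurableSet_X1.inter <| .iInter fun p => measurableSet_omitsMod _ _

variable {μ : Measure Omega2}

lemma measure_omittedFiber_add_one (hμ : MeasurePreserving shift μ μ) (hX : ∀ᵐ x ∂μ, x ∈ X1)
    (S : Finset Nat.Primes) (h : ∀ p : S, ZMod ((p : ℕ) ^ 2)) :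
    μ (omittedFiber S (h + 1)) = μ (omittedFiber S h) := by
  rw [← hμ.measure_preimage (measurableSet_omittedFiber S h).nullMeasurableSet]
  refine measure_congr ?_
  filter_upwards [hX, hμ.quasiMeasurePreserving.ae hX] with x hx hx'
  refine propext ?_
  change x ∈ omittedFiber S (h + 1) ↔ shift x ∈ omittedFiber S h
  simp only [omittedFiber_eq, mem_inter_iff, mem_iInter, hx, hx', true_and, mem_ofPred_eq]
  refine forall_congr' fun p => ?_
  rw [((mem_X1_iff.1 hx p).2).omitsMod_shift_iff]
  rfl

lemma exists_natCast_eq (S : Finset Nat.Primes) (h : ∀ p : S, ZMod ((p : ℕ) ^ 2)) :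
    ∃ n : ℕ, (n : ∀ p : S, ZMod ((p : ℕ) ^ 2)) = h := by
  obtain ⟨n, hn⟩ := Nat.chineseRemainderOfFinset (fun p : S => (h p).val)
    (fun p : S => (p : ℕ) ^ 2) Finset.univ (fun p _ => pow_ne_zero 2 p.1.2.ne_zero)
    (fun p _ q _ hpq => Nat.Coprime.pow 2 2 ((Nat.coprime_primes p.1.2 q.1.2).2
      fun e => hpq (Subtype.ext (Subtype.ext e))))
  refine ⟨n, funext fun p => ?_⟩
  have := (ZMod.natCast_eq_natCast_iff _ _ _).2 (hn p (Finset.mem_univ p))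
  simpa using this

lemma measure_omittedFiber_eq (hμ : MeasurePreserving shift μ μ) (hX : ∀ᵐ x ∂μ, x ∈ X1)
    (S : Finset Nat.Primes) (h : ∀ p : S, ZMod ((p : ℕ) ^ 2)) :
    μ (omittedFiber S h) = μ (omittedFiber S 0) := by
  obtain ⟨n, rfl⟩ := exists_natCast_eq S h
  induction n with
  | zero => simp
  | succ n ih => rw [Nat.cast_succ, measure_omittedFiber_add_one hμ hX, ih]

lemma measure_rho_mem (hμ : MeasurePreserving shift μ μ) (hX : ∀ᵐ x ∂μ, x ∈ X1)
    (S : Finset Nat.Primes) (F : Finset (∀ p : S, ZMod ((p : ℕ) ^ 2))) :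
    μ {x ∈ X1 | (fun p : S => rho x p) ∈ F} = F.card * μ (omittedFiber S 0) := by
  have hU : {x ∈ X1 | (fun p : S => rho x p) ∈ F} = ⋃ h ∈ F, omittedFiber S h := by
    ext x
    simp only [omittedFiber, mem_ofPred_eq, mem_iUnion, exists_prop, ← funext_iff]
    grind
  rw [hU, measure_biUnion_finset _ fun h _ => measurableSet_omittedFiber S h,
    Finset.sum_congr rfl fun h _ => measure_omittedFiber_eq hμ hX S h]
  · simp
  · intro h _ h' _ hne
    refine Set.disjoint_left.2 fun x hx hx' => hne (funext fun p => ?_)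
    rw [← hx.2 p, hx'.2 p]

/-- The sequences in `X₁` whose omitted class modulo `p ^ 2` is not `1` for any `p ∈ S`. -/
def rhoNeOne (S : Finset Nat.Primes) : Set Omega2 := {x ∈ X1 | ∀ p ∈ S, rho x p ≠ 1}

lemma measurableSet_rhoNeOne (S : Finset Nat.Primes) : MeasurableSet (rhoNeOne S) := by
  have : rhoNeOne S = X1 ∩ ⋂ p ∈ S, {x | OmitsMod x ((p : ℕ) ^ 2) 1}ᶜ := by
    ext x
    simp only [rhoNeOne, mem_ofPred_eq, mem_inter_iff, mem_iInter, mem_compl_iff]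
    refine and_congr_right fun hx => forall₂_congr fun p _ => ?_
    rw [omitsMod_iff_of_mem_X1 hx, eq_comm]
  rw [this]
  exact measurableSet_X1.inter <| Finset.measurableSet_biInter _ fun p _ =>
    (measurableSet_omitsMod _ _).compl

lemma measure_rhoNeOne [IsProbabilityMeasure μ] (hμ : MeasurePreserving shift μ μ)
    (hX : ∀ᵐ x ∂μ, x ∈ X1) (S : Finset Nat.Primes) :
    μ.real (rhoNeOne S) = ∏ p ∈ S, (1 - 1 / ((p : ℕ) : ℝ) ^ 2) := by
  have htotal := measure_rho_mem hμ hX S Finset.univ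
  have hne := measure_rho_mem hμ hX S
    (Fintype.piFinset fun p : S => ({1}ᶜ : Finset (ZMod ((p : ℕ) ^ 2))))
  have h1 : μ X1 = 1 := (prob_compl_eq_zero_iff measurableSet_X1).1 hX
  simp only [Finset.mem_univ, and_true, ofPred_mem_eq, h1, Finset.card_univ, Fintype.card_pi,
    ZMod.card] at htotal
  have hset : {x ∈ X1 | (fun p : S => rho x p) ∈
      Fintype.piFinset fun p : S => ({1}ᶜ : Finset (ZMod ((p : ℕ) ^ 2)))} = rhoNeOne S := by
    ext x
    simp [rhoNeOne]
  rw [hset, Fintype.card_piFinset] at hne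
  simp only [Finset.card_compl, Finset.card_singleton, ZMod.card] at hne
  apply_fun ENNReal.toReal at htotal hne
  have hfactor : ∀ p : Nat.Primes, (1 - 1 / ((p : ℕ) : ℝ) ^ 2) =
      (((p : ℕ) ^ 2 - 1 : ℕ) : ℝ) / (((p : ℕ) ^ 2 : ℕ) : ℝ) := fun p => by
    have hp : (p : ℕ) ^ 2 ≠ 0 := pow_ne_zero 2 p.2.ne_zero
    rw [Nat.cast_sub (Nat.one_le_iff_ne_zero.2 hp), sub_div, div_self (Nat.cast_ne_zero.2 hp)]
    push_cast
    rfl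
  rw [Finset.prod_coe_sort S fun p : Nat.Primes => (p : ℕ) ^ 2 - 1] at hne
  rw [Finset.prod_coe_sort S fun p : Nat.Primes => (p : ℕ) ^ 2] at htotal
  simp only [ENNReal.toReal_mul, ENNReal.toReal_natCast, ENNReal.toReal_one] at htotal hne
  rw [Measure.real, hne, Finset.prod_congr rfl fun p _ => hfactor p, Finset.prod_div_distrib,
    ← Nat.cast_prod, ← Nat.cast_prod, eq_div_iff (left_ne_zero_of_mul (htotal ▸ one_ne_zero)),
    mul_assoc, mul_comm (ENNReal.toReal _), ← htotal, mul_one]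

lemma Y_eq_iInter_rhoNeOne : Y = ⋂ S : Finset Nat.Primes, rhoNeOne S := by
  ext x
  simp only [Y, G1, rhoNeOne, mem_ofPred_eq, mem_compl_iff, not_exists, mem_iInter]
  exact ⟨fun h S => ⟨h.1, fun p _ => h.2 p⟩,
    fun h => ⟨(h ∅).1, fun p => (h {p}).2 p (Finset.mem_singleton_self p)⟩⟩

end OmittedResidues

/-- Every `σ`-ergodic shift-invariant Borel probability measure `μ` on
the squarefree flow with `μ(X₁) = 1` satisfies `μ(Y) = ∏_p (1 − 1/p²)`. -/
theorem ergodic_measure_of_Y (μ : Measure Omega2) (hprob : IsProbabilityMeasure μ)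
    (herg : Ergodic shift μ) (h1 : μ X1 = 1) :
    μ Y = ENNReal.ofReal (∏' p : Nat.Primes, (1 - 1 / ((p : ℕ) : ℝ) ^ 2)) := by
  have hX : ∀ᵐ x ∂μ, x ∈ X1 := (prob_compl_eq_zero_iff measurableSet_X1).2 h1
  have hlim : Tendsto (fun S => μ (rhoNeOne S)) atTop (nhds (μ Y)) := by
    rw [Y_eq_iInter_rhoNeOne]
    exact tendsto_measure_iInter_atTop (fun S => (measurableSet_rhoNeOne S).nullMeasurableSet)
      (fun S T hST x hx => ⟨hx.1, fun p hp => hx.2 p (hST hp)⟩) ⟨∅, measure_ne_top _ _⟩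
  have hprod : HasProd (fun p : Nat.Primes => 1 - 1 / ((p : ℕ) : ℝ) ^ 2) (μ.real Y) :=
    ((ENNReal.tendsto_toReal (measure_ne_top μ Y)).comp hlim).congr
      (measure_rhoNeOne herg.toMeasurePreserving hX)
  rw [hprod.tprod_eq, ofReal_measureReal]

end
end

section
/- Let g ∈ G₁^c with finite first-return time r₁(g) = min{n ≥ 1 : T₁ⁿ g ∈ G₁^c} < ∞, and let y ∈ Ω⁽²⁾. Then the induced transformation of the skew product T on G₁^c × Ω⁽²⁾ acts as a direct product: T^{r₁(g)}(g, y) = (T₁^{r₁(g)} g, σ y). Consequently, for any T-invariant Borel probability measure μ on G × Ω⁽²⁾, the induced map T̄ on G₁^c × Ω⁽²⁾ equals T̄₁ × σ μ-almost everywhere, where T̄₁ is the transformation induced from T₁ on G₁^c. -/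
open MeasureTheory Filter Set
open scoped ENNReal Classical

noncomputable section

/-- The skew product factors onto the translation `T1`. -/
theorem skewT_iterate_fst (n : ℕ) (gy : G × Omega2) : (skewT^[n] gy).1 = T1^[n] gy.1 := by
  have h : Function.Semiconj Prod.fst skewT T1 := by
    intro x
    unfold skewT
    split_ifs <;> rfl
  exact h.iterate_right n gy

/-- Starting from `G1ᶜ`, the fibre is shifted exactly once as long as the base orbit
stays in `G1`. -/
theorem skewT_iterate_of_forall_mem_G1 {g : G} (y : Omega2) (hg : g ∈ G1ᶜ) (n : ℕ)
    (h : ∀ k, 0 < k → k < n + 1 → T1^[k] g ∈ G1) :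
    skewT^[n + 1] (g, y) = (T1^[n + 1] g, shift y) := by
  induction n with
  | zero =>
    have hg' : g ∉ G1 := hg
    simp [skewT, hg']
  | succ n ih =>
    rw [Function.iterate_succ_apply', ih fun k hk hkn => h k hk (by omega),
      Function.iterate_succ_apply' T1 (n + 1)]
    simp only [skewT, if_pos (h (n + 1) (by omega) (by omega))]

theorem skewT_iterate_retTime {g : G} (y : Omega2) (hg : g ∈ G1ᶜ)
    (h : ∃ n : ℕ, 0 < n ∧ T1^[n] g ∈ G1ᶜ) :
    skewT^[retTime T1 G1ᶜ g] (g, y) = (T1^[retTime T1 G1ᶜ g] g, shift y) := by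
  have hpos : 0 < retTime T1 G1ᶜ g := (Nat.sInf_mem h).1
  obtain ⟨n, hn⟩ := Nat.exists_eq_succ_of_ne_zero hpos.ne'
  rw [hn]
  refine skewT_iterate_of_forall_mem_G1 y hg n fun k hk hkn => ?_
  by_contra hk'
  have hle : retTime T1 G1ᶜ g ≤ k := Nat.sInf_le ⟨hk, hk'⟩
  omega

theorem mem_ZSet_iff {gy : G × Omega2} : gy ∈ ZSet ↔ gy.1 ∈ G1ᶜ := by
  simp [ZSet]

theorem retTime_skewT (gy : G × Omega2) : retTime skewT ZSet gy = retTime T1 G1ᶜ gy.1 := by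
  simp only [retTime, mem_ZSet_iff, skewT_iterate_fst]

theorem measurableSet_G1 : MeasurableSet G1 := by
  have h : G1 = ⋃ p : Nat.Primes, (fun g : G => g p) ⁻¹' {1} := by
    ext g
    simp [G1]
  rw [h]
  exact MeasurableSet.iUnion fun p => measurable_pi_apply p MeasurableSpace.measurableSet_top

theorem measurableSet_ZSet : MeasurableSet ZSet :=
  measurableSet_G1.compl.prod MeasurableSet.univ

/-- For `g ∈ G₁ᶜ` with finite first-return time
`r₁(g) = min{n ≥ 1 : T₁ⁿ g ∈ G₁ᶜ}` and any `y ∈ Ω⁽²⁾`, the induced transformation of the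
skew product acts as a direct product: `T^{r₁(g)}(g, y) = (T₁^{r₁(g)} g, σ y)`.
Consequently, for any `T`-invariant Borel probability measure `μ` on `G × Ω⁽²⁾`, the
induced map `T̄` on `G₁ᶜ × Ω⁽²⁾` equals `T̄₁ × σ` `μ`-almost everywhere. -/
theorem induced_skew_is_product :
    (∀ (g : G) (y : Omega2), g ∈ G1ᶜ → (∃ n : ℕ, 0 < n ∧ T1^[n] g ∈ G1ᶜ) →
      skewT^[retTime T1 G1ᶜ g] (g, y) = (T1^[retTime T1 G1ᶜ g] g, shift y)) ∧
    (∀ μ : Measure (G × Omega2), IsProbabilityMeasure μ → MeasurePreserving skewT μ μ →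
      ∀ᵐ gy ∂μ, gy.1 ∈ G1ᶜ →
        inducedAmb skewT ZSet gy = (inducedAmb T1 G1ᶜ gy.1, shift gy.2)) := by
  refine ⟨fun g y hg h => skewT_iterate_retTime y hg h, fun μ _ hμ => ?_⟩
  filter_upwards [hμ.conservative.ae_mem_imp_frequently_image_mem
    measurableSet_ZSet.nullMeasurableSet] with gy hrec hg
  obtain ⟨n, hn, hmem⟩ := frequently_atTop.1 (hrec (mem_ZSet_iff.2 hg)) 1
  rw [mem_ZSet_iff, skewT_iterate_fst] at hmem
  rw [inducedAmb, retTime_skewT]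
  exact skewT_iterate_retTime gy.2 hg ⟨n, hn, hmem⟩

end
end

section
/- For every x ∈ Y, the first-return time r₁(g_x) = min{n ≥ 1 : T₁ⁿ(g_x) ∈ G₁^c} is finite. -/
open MeasureTheory Filter Set
open scoped ENNReal Classical

noncomputable section

theorem T1_iterate (n : ℕ) (g : G) (p : Nat.Primes) : T1^[n] g p = g p - n := by
  induction n with
  | zero => simp
  | succ n ih => rw [Function.iterate_succ_apply', T1, ih]; push_cast; ring

theorem omitsMod_rho {x : Omega2} (hx : x ∈ SqfFlow) (p : Nat.Primes) :
    OmitsMod x ((p : ℕ) ^ 2) (rho x p) := by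
  rw [rho, dif_pos (hx p)]
  exact (hx p).choose_spec

theorem T1_iterate_rho_mem_compl_G1 {x : Omega2} (hx : x ∈ SqfFlow) {n : ℕ} (hn : x n = true) :
    T1^[n] (rho x) ∈ G1ᶜ := by
  rintro ⟨p, hp⟩
  rw [T1_iterate] at hp
  have h : ((n + 1 : ℕ) : ZMod ((p : ℕ) ^ 2)) = rho x p := by
    push_cast
    linear_combination -hp
  simp [omitsMod_rho hx p n h] at hn

theorem exists_not_omitsMod_of_mem_X1 {x : Omega2} (hx : x ∈ X1) (p : Nat.Primes) :
    ∃ a : ZMod ((p : ℕ) ^ 2), ¬ OmitsMod x ((p : ℕ) ^ 2) a := by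
  by_contra! h
  have hcard : numOmitted x ((p : ℕ) ^ 2) = 1 := hx.2.1 p
  have huniv : {a : ZMod ((p : ℕ) ^ 2) | OmitsMod x ((p : ℕ) ^ 2) a} = Set.univ :=
    Set.eq_univ_of_forall h
  rw [numOmitted, huniv, Set.ncard_univ, Nat.card_zmod] at hcard
  exact (Nat.one_lt_pow two_ne_zero p.2.one_lt).ne' hcard

theorem exists_pos_eq_true_of_mem_X1 {x : Omega2} (hx : x ∈ X1) : ∃ n : ℕ, 1 ≤ n ∧ x n = true := by
  let p : Nat.Primes := ⟨2, Nat.prime_two⟩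
  obtain ⟨a, ha⟩ := exists_not_omitsMod_of_mem_X1 hx p
  simp only [OmitsMod, not_forall, Bool.not_eq_false] at ha
  obtain ⟨m, hma, hm⟩ := ha
  obtain ⟨n, ⟨-, hn⟩, hpos⟩ := (hx.2.2 p a ⟨m, hma, hm⟩).exists_gt 0
  exact ⟨n, hpos, hn⟩

/-- For every `x ∈ Y`, the first-return time
`r₁(g_x) = min{n ≥ 1 : T₁ⁿ(g_x) ∈ G₁ᶜ}` is finite, i.e. some iterate `T₁ⁿ(g_x)` with
`n ≥ 1` lies in `G₁ᶜ`. -/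
theorem return_time_finite : ∀ x ∈ Y, ∃ n : ℕ, 1 ≤ n ∧ T1^[n] (rho x) ∈ G1ᶜ := by
  rintro x ⟨hx, -⟩
  obtain ⟨n, hpos, hn⟩ := exists_pos_eq_true_of_mem_X1 hx
  exact ⟨n, hpos, T1_iterate_rho_mem_compl_G1 hx.1 hn⟩

end
end
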